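/- arXiv:1910.04110 — 2 statements merged into one kernel-verified Lean document; each statement's English description precedes it below -/
import Mathlib

section
/- One has μ^l(v) ≠ 0 and μ^l(v^{-1}) ≠ 0, and the Drinfeld map D(φ) = Σ_{i,j} φ(g a_i b_j)·b_i a_j satisfies D(φ_v) = v and D(φ_{v^{-1}}) = v^{-1}, where φ_v = μ^l(v^{-1})^{-1}·μ^l(g^{-1}v^{-1}·?) and φ_{v^{-1}} = μ^l(v)^{-1}·μ^l(g^{-1}v·?). Consequently: (1) φ_v and φ_{v^{-1}} belong to SLF(H); (2) μ^r(gxy) = μ^r(gyx) and μ^l(g^{-1}xy) = μ^l(g^{-1}yx) for all x, y ∈ H; (3) μ^r(xy) = μ^r(S²(y)x) and μ^l(xy) = μ^l(S^{-2}(y)x) for all x, y ∈ H. -/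
/- STATEMENT 1: `μˡ(v) ≠ 0`, `μˡ(v⁻¹) ≠ 0`, the Drinfeld map sends `φ_v ↦ v`,
`φ_{v⁻¹} ↦ v⁻¹`; consequently `φ_v, φ_{v⁻¹} ∈ SLF(H)`, `μʳ(g·)` and `μˡ(g⁻¹·)` are
symmetric, and `μʳ(xy) = μʳ(S²(y)x)`, `μˡ(xy) = μˡ(S⁻²(y)x)`. -/

noncomputable section

open scoped TensorProduct
open TensorProduct

/-- Symmetric linear forms on `H`. -/
def IsSLF {H : Type} [Ring H] [Algebra ℂ H] (φ : Module.Dual ℂ H) : Prop :=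
  ∀ x y : H, φ (x * y) = φ (y * x)

/-- The convolution product on the dual of a Hopf algebra: `(φψ)(x) = φ(x')ψ(x'')`. -/
def conv {H : Type} [Ring H] [HopfAlgebra ℂ H] (φ ψ : Module.Dual ℂ H) :
    Module.Dual ℂ H :=
  LinearMap.mul' ℂ ℂ ∘ₗ TensorProduct.map φ ψ ∘ₗ (Coalgebra.comul (R := ℂ) (A := H))

/-- The Drinfeld map `D(φ) = (φ ⊗ id)((g ⊗ 1)·RR') = Σ_{i,j} φ(g aᵢ bⱼ) • bᵢ aⱼ`. -/
def drinfeldMap {H ι : Type} [Ring H] [Algebra ℂ H] [Fintype ι]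
    (aR bR : ι → H) (g : H) (φ : Module.Dual ℂ H) : H :=
  ∑ i, ∑ j, φ (g * (aR i * bR j)) • (bR i * aR j)

open Coalgebra HopfAlgebra

lemma sum_comul_coassoc {H V : Type} [Ring H] [HopfAlgebra ℂ H] [AddCommGroup V] [Module ℂ V]
    (f : H → H → H → V) (h₁ : ∀ b c, IsLinearMap ℂ fun a => f a b c)
    (h₂ : ∀ a c, IsLinearMap ℂ fun b => f a b c) (h₃ : ∀ a b, IsLinearMap ℂ fun c => f a b c)
    (y : H) :
    ∑ i ∈ (ℛ ℂ y).index, ∑ j ∈ (ℛ ℂ ((ℛ ℂ y).left i)).index,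
        f ((ℛ ℂ ((ℛ ℂ y).left i)).left j) ((ℛ ℂ ((ℛ ℂ y).left i)).right j) ((ℛ ℂ y).right i)
      = ∑ i ∈ (ℛ ℂ y).index, ∑ j ∈ (ℛ ℂ ((ℛ ℂ y).right i)).index,
        f ((ℛ ℂ y).left i) ((ℛ ℂ ((ℛ ℂ y).right i)).left j)
          ((ℛ ℂ ((ℛ ℂ y).right i)).right j) := by
  let F : H →ₗ[ℂ] H →ₗ[ℂ] H →ₗ[ℂ] V :=
    LinearMap.mk₂ ℂ (fun a b => (h₃ a b).mk' _)
      (fun a a' b => LinearMap.ext fun c => (h₁ b c).map_add a a')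
      (fun r a b => LinearMap.ext fun c => (h₁ b c).map_smul r a)
      (fun a b b' => LinearMap.ext fun c => (h₂ a c).map_add b b')
      (fun r a b => LinearMap.ext fun c => (h₂ a c).map_smul r b)
  have h := congrArg (TensorProduct.lift (TensorProduct.uncurry (.id ℂ) H H V ∘ₗ F))
    (sum_tmul_tmul_eq (ℛ ℂ y) (fun i => ℛ ℂ ((ℛ ℂ y).left i)) (fun i => ℛ ℂ ((ℛ ℂ y).right i)))
  simpa [F] using h

/-- The linear map `p ⊗ q ↦ β(p) q`. -/
def partialEval {H : Type} [Ring H] [Algebra ℂ H] (β : Module.Dual ℂ H) : H ⊗[ℂ] H →ₗ[ℂ] H :=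
  (TensorProduct.lid ℂ H).toLinearMap ∘ₗ LinearMap.rTensor H β

@[simp]
lemma partialEval_tmul {H : Type} [Ring H] [Algebra ℂ H] (β : Module.Dual ℂ H) (p q : H) :
    partialEval β (p ⊗ₜ q) = β p • q := by
  simp [partialEval]

lemma partialEval_mul_one_tmul {H : Type} [Ring H] [Algebra ℂ H] (β : Module.Dual ℂ H)
    (M : H ⊗[ℂ] H) (y : H) : partialEval β (M * (1 ⊗ₜ y)) = partialEval β M * y := by
  induction M with
  | zero => simp
  | tmul p q => simp
  | add s t hs ht => simp [add_mul, hs, ht]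

lemma partialEval_one_tmul_mul {H : Type} [Ring H] [Algebra ℂ H] (β : Module.Dual ℂ H)
    (M : H ⊗[ℂ] H) (y : H) : partialEval β ((1 ⊗ₜ y) * M) = y * partialEval β M := by
  induction M with
  | zero => simp
  | tmul p q => simp
  | add s t hs ht => simp [mul_add, hs, ht]

section AntipodeInverse

variable {H : Type} [Ring H] [HopfAlgebra ℂ H]

lemma antipodeInv_mul {Sinv : H →ₗ[ℂ] H} (hSinv₁ : ∀ x : H, Sinv (antipode ℂ x) = x)
    (hSinv₂ : ∀ x : H, antipode ℂ (Sinv x) = x) (x y : H) :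
    Sinv (x * y) = Sinv y * Sinv x := by
  have h := hSinv₁ (Sinv y * Sinv x)
  rwa [antipode_mul_antidistrib, hSinv₂, hSinv₂] at h

lemma antipodeInv_one {Sinv : H →ₗ[ℂ] H} (hSinv₁ : ∀ x : H, Sinv (antipode ℂ x) = x) :
    Sinv 1 = 1 := by
  simpa [antipode_one] using hSinv₁ 1

lemma sum_antipodeInv_right_mul_left {Sinv : H →ₗ[ℂ] H}
    (hSinv₁ : ∀ x : H, Sinv (antipode ℂ x) = x)
    (hSinv₂ : ∀ x : H, antipode ℂ (Sinv x) = x) (y : H) :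
    ∑ i ∈ (ℛ ℂ y).index, Sinv ((ℛ ℂ y).right i) * (ℛ ℂ y).left i = counit (R := ℂ) y • 1 := by
  simpa [antipodeInv_mul hSinv₁ hSinv₂, hSinv₁, antipodeInv_one hSinv₁] using
    congrArg Sinv (sum_antipode_mul_eq_smul (R := ℂ) (ℛ ℂ y))

lemma sum_right_mul_antipodeInv_left {Sinv : H →ₗ[ℂ] H}
    (hSinv₁ : ∀ x : H, Sinv (antipode ℂ x) = x)
    (hSinv₂ : ∀ x : H, antipode ℂ (Sinv x) = x) (y : H) :
    ∑ i ∈ (ℛ ℂ y).index, (ℛ ℂ y).right i * Sinv ((ℛ ℂ y).left i) = counit (R := ℂ) y • 1 := by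
  simpa [antipodeInv_mul hSinv₁ hSinv₂, hSinv₁, antipodeInv_one hSinv₁] using
    congrArg Sinv (sum_mul_antipode_eq_smul (R := ℂ) (ℛ ℂ y))

end AntipodeInverse

section Centrality

variable {H : Type} [Ring H] [HopfAlgebra ℂ H]

lemma eq_zero_of_sum_right_mul_left {Sinv : H →ₗ[ℂ] H}
    (hSinv₁ : ∀ x : H, Sinv (antipode ℂ x) = x)
    (hSinv₂ : ∀ x : H, antipode ℂ (Sinv x) = x) (G : H →ₗ[ℂ] H)
    (hG : ∀ y, ∑ i ∈ (ℛ ℂ y).index, G ((ℛ ℂ y).right i) * (ℛ ℂ y).left i = 0) (y : H) :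
    G y = 0 := by
  have h := sum_comul_coassoc (fun a b c : H => G c * (b * Sinv a))
    (fun b c => ⟨by simp [mul_add], by simp⟩) (fun a c => ⟨by simp [mul_add, add_mul], by simp⟩)
    (fun a b => ⟨by simp [add_mul], by simp⟩) y
  simp only [← Finset.mul_sum, sum_right_mul_antipodeInv_left hSinv₁ hSinv₂] at h
  simp only [← mul_assoc, ← Finset.sum_mul, hG] at h
  simp only [mul_smul_comm, mul_one, zero_mul, Finset.sum_const_zero] at h
  simp only [← map_smul, ← map_sum, sum_counit_smul] at h
  exact h

lemma sum_eval_conj_eq_counit_smul {Sinv : H →ₗ[ℂ] H}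
    (hSinv₁ : ∀ x : H, Sinv (antipode ℂ x) = x)
    (hSinv₂ : ∀ x : H, antipode ℂ (Sinv x) = x) (M : H ⊗[ℂ] H)
    (hM : ∀ y : H, M * TensorProduct.comm ℂ H H (comul (R := ℂ) y)
      = TensorProduct.comm ℂ H H (comul (R := ℂ) y) * M)
    (β : Module.Dual ℂ H) (hβ : ∀ y, y * partialEval β M = partialEval β M * y) (y : H) :
    ∑ i ∈ (ℛ ℂ y).index, partialEval β
        ((Sinv ((ℛ ℂ y).right i) ⊗ₜ 1) * (M * ((ℛ ℂ y).left i ⊗ₜ 1)))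
      = counit (R := ℂ) y • partialEval β M := by
  let B : H →ₗ[ℂ] H →ₗ[ℂ] H :=
    LinearMap.mk₂ ℂ (fun p z => partialEval β ((Sinv z ⊗ₜ 1) * (M * (p ⊗ₜ 1))))
      (by simp [add_tmul, mul_add]) (by simp [← smul_tmul'])
      (by simp [add_tmul, add_mul]) (by simp [← smul_tmul'])
  let F : H →ₗ[ℂ] H := TensorProduct.lift B ∘ₗ comul
  have hF (y : H) : F y = ∑ i ∈ (ℛ ℂ y).index, partialEval β
        ((Sinv ((ℛ ℂ y).right i) ⊗ₜ 1) * (M * ((ℛ ℂ y).left i ⊗ₜ 1))) := by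
    simp [F, B, ← (ℛ ℂ y).eq]
  rw [← hF, ← sub_eq_zero]
  refine eq_zero_of_sum_right_mul_left hSinv₁ hSinv₂
    (F - (counit (R := ℂ) (A := H)).smulRight (partialEval β M)) (fun y => ?_) y
  have h₁ := sum_comul_coassoc
    (fun w p z : H => partialEval β ((Sinv z ⊗ₜ 1) * (M * (p ⊗ₜ w))))
    (fun b c => ⟨by simp [tmul_add, mul_add], by simp⟩)
    (fun a c => ⟨by simp [add_tmul, mul_add], by simp [← smul_tmul']⟩)
    (fun a b => ⟨by simp [add_tmul, add_mul], by simp [← smul_tmul']⟩) y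
  have h₂ := sum_comul_coassoc
    (fun w p z : H => partialEval β ((Sinv z ⊗ₜ 1) * ((p ⊗ₜ w) * M)))
    (fun b c => ⟨by simp [tmul_add, mul_add, add_mul], by simp⟩)
    (fun a c => ⟨by simp [add_tmul, mul_add, add_mul], by simp [← smul_tmul']⟩)
    (fun a b => ⟨by simp [add_tmul, add_mul], by simp [← smul_tmul']⟩) y
  have key (x z : H) :
      ∑ j ∈ (ℛ ℂ x).index, partialEval β
        ((Sinv z ⊗ₜ 1) * (M * ((ℛ ℂ x).right j ⊗ₜ (ℛ ℂ x).left j)))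
      = ∑ j ∈ (ℛ ℂ x).index, partialEval β
        ((Sinv z ⊗ₜ 1) * (((ℛ ℂ x).right j ⊗ₜ (ℛ ℂ x).left j) * M)) := by
    have := congrArg (fun t => partialEval β ((Sinv z ⊗ₜ 1) * t)) (hM x)
    simpa [← (ℛ ℂ x).eq, Finset.mul_sum, Finset.sum_mul] using this
  simp only [key] at h₁
  rw [h₁] at h₂
  have hleft (x w : H) : ∑ j ∈ (ℛ ℂ x).index,
      partialEval β ((Sinv ((ℛ ℂ x).right j) ⊗ₜ 1) * (M * ((ℛ ℂ x).left j ⊗ₜ w)))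
        = F x * w := by
    simp_rw [hF, Finset.sum_mul, ← partialEval_mul_one_tmul, mul_assoc,
      Algebra.TensorProduct.tmul_mul_tmul, mul_one, one_mul]
  have hright (p w z : H) : partialEval β ((Sinv z ⊗ₜ 1) * ((p ⊗ₜ w) * M))
      = partialEval β (((Sinv z * p) ⊗ₜ w) * M) := by
    rw [← mul_assoc, Algebra.TensorProduct.tmul_mul_tmul, one_mul]
  have hcancel (z w : H) : ∑ j ∈ (ℛ ℂ z).index,
      partialEval β (((Sinv ((ℛ ℂ z).right j) * (ℛ ℂ z).left j) ⊗ₜ w) * M)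
        = counit (R := ℂ) z • (w * partialEval β M) := by
    rw [← map_sum, ← Finset.sum_mul, ← TensorProduct.sum_tmul,
      sum_antipodeInv_right_mul_left hSinv₁ hSinv₂, ← smul_tmul', smul_mul_assoc, map_smul,
      partialEval_one_tmul_mul]
  simp only [hleft, hright, hcancel, hβ] at h₂
  simp [sub_mul, h₂]

lemma eval_mul_of_central {Sinv : H →ₗ[ℂ] H}
    (hSinv₁ : ∀ x : H, Sinv (antipode ℂ x) = x)
    (hSinv₂ : ∀ x : H, antipode ℂ (Sinv x) = x) (M : H ⊗[ℂ] H)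
    (hM : ∀ y : H, M * TensorProduct.comm ℂ H H (comul (R := ℂ) y)
      = TensorProduct.comm ℂ H H (comul (R := ℂ) y) * M)
    (hinj : ∀ β : Module.Dual ℂ H, partialEval β M = 0 → β = 0)
    (β : Module.Dual ℂ H) (hβ : ∀ y, y * partialEval β M = partialEval β M * y) (x y : H) :
    β (x * y) = β (Sinv (Sinv y) * x) := by
  have inv (x y : H) : ∑ i ∈ (ℛ ℂ y).index,
      β (Sinv ((ℛ ℂ y).right i) * (x * (ℛ ℂ y).left i)) = counit (R := ℂ) y * β x := by
    have h := hinj ((∑ i ∈ (ℛ ℂ y).index, β ∘ₗ LinearMap.mulLeft ℂ (Sinv ((ℛ ℂ y).right i)) ∘ₗ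
      LinearMap.mulRight ℂ ((ℛ ℂ y).left i)) - counit (R := ℂ) y • β) ?_
    · simpa [sub_eq_zero] using LinearMap.congr_fun h x
    · have hlin (t : H ⊗[ℂ] H) : partialEval ((∑ i ∈ (ℛ ℂ y).index,
          β ∘ₗ LinearMap.mulLeft ℂ (Sinv ((ℛ ℂ y).right i)) ∘ₗ
          LinearMap.mulRight ℂ ((ℛ ℂ y).left i)) - counit (R := ℂ) y • β) t
          = ∑ i ∈ (ℛ ℂ y).index, partialEval β
            ((Sinv ((ℛ ℂ y).right i) ⊗ₜ 1) * (t * ((ℛ ℂ y).left i ⊗ₜ 1)))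
            - counit (R := ℂ) y • partialEval β t := by
        induction t with
        | zero => simp
        | tmul p q => simp [sub_smul, Finset.sum_smul, mul_smul]
        | add s t hs ht =>
          simp only [map_add, hs, ht, add_mul, mul_add, Finset.sum_add_distrib, smul_add]
          abel
      rw [hlin, sum_eval_conj_eq_counit_smul hSinv₁ hSinv₂ M hM β hβ, sub_self]
  have h := sum_comul_coassoc
    (fun a b c : H => β (Sinv b * (Sinv (Sinv c) * x * a)))
    (fun b c => ⟨by simp [mul_add], by simp⟩) (fun a c => ⟨by simp [add_mul], by simp⟩)
    (fun a b => ⟨by simp [mul_add, add_mul], by simp⟩) y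
  simp only [inv] at h
  have hcancel (z a : H) : ∑ j ∈ (ℛ ℂ z).index,
      β (Sinv ((ℛ ℂ z).left j) * (Sinv (Sinv ((ℛ ℂ z).right j)) * x * a))
        = counit (R := ℂ) z * β (x * a) := by
    have := congrArg (fun t => β (Sinv t * (x * a)))
      (sum_antipodeInv_right_mul_left hSinv₁ hSinv₂ z)
    simpa [antipodeInv_mul hSinv₁ hSinv₂, antipodeInv_one hSinv₁, Finset.sum_mul, mul_assoc]
      using this
  simp only [hcancel] at h
  have e₁ := congrArg (fun t => β (Sinv (Sinv t) * x)) (sum_counit_smul (R := ℂ) (ℛ ℂ y))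
  have e₂ : ∑ i ∈ (ℛ ℂ y).index, counit (R := ℂ) ((ℛ ℂ y).right i) • (ℛ ℂ y).left i = y := by
    simpa only [map_sum, TensorProduct.rid_tmul, one_smul] using
      congrArg (TensorProduct.rid ℂ H) (sum_tmul_counit_eq (R := ℂ) (ℛ ℂ y))
  have e₃ := congrArg (fun t => β (x * t)) e₂
  simp only [map_sum, map_smul, Finset.sum_mul, Finset.mul_sum, smul_mul_assoc, mul_smul_comm,
    smul_eq_mul] at e₁ e₃
  rw [← e₁, ← e₃, h]

end Centrality

section RMatrix

variable {H ι : Type} [Ring H] [HopfAlgebra ℂ H] [Fintype ι]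

lemma sum_antipode_tmul_mul_rMatrix {aR bR : ι → H}
    (hRinv : IsUnit (∑ i, aR i ⊗ₜ[ℂ] bR i : H ⊗[ℂ] H))
    (hR₁ : (∑ i, (comul (R := ℂ) (aR i)) ⊗ₜ[ℂ] bR i)
        = ∑ i, ∑ j, (aR i ⊗ₜ[ℂ] aR j) ⊗ₜ[ℂ] (bR i * bR j)) :
    (∑ i, antipode ℂ (aR i) ⊗ₜ[ℂ] bR i) * (∑ i, aR i ⊗ₜ[ℂ] bR i) = 1 := by
  have hcounit : ∑ i, counit (R := ℂ) (aR i) • bR i = 1 := by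
    have h := congrArg (LinearMap.rTensor H ((TensorProduct.lid ℂ H).toLinearMap ∘ₗ
      LinearMap.rTensor H (counit (R := ℂ)))) hR₁
    have h' : (∑ i, aR i ⊗ₜ[ℂ] bR i)
        = (1 ⊗ₜ (∑ i, counit (R := ℂ) (aR i) • bR i)) * ∑ i, aR i ⊗ₜ[ℂ] bR i := by
      simpa [Finset.sum_mul_sum, TensorProduct.tmul_sum, ← smul_tmul'] using h
    have h₁ := hRinv.mul_right_cancel ((one_mul _).trans h')
    simpa [Algebra.TensorProduct.one_def] using congrArg ((TensorProduct.lid ℂ H).toLinearMap ∘ₗ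
      LinearMap.rTensor H (counit (R := ℂ))) h₁.symm
  have h := congrArg (LinearMap.rTensor H (LinearMap.mul' ℂ H ∘ₗ
    LinearMap.rTensor H (antipode ℂ))) hR₁
  simp only [map_sum, LinearMap.rTensor_tmul, LinearMap.comp_apply,
    mul_antipode_rTensor_comul_apply, LinearMap.mul'_apply] at h
  simp only [Finset.sum_mul_sum, Algebra.TensorProduct.tmul_mul_tmul, ← h,
    Algebra.algebraMap_eq_smul_one, smul_tmul, ← TensorProduct.tmul_sum, hcounit]
  rfl

lemma sum_tmul_antipodeInv_mul_rMatrix {Sinv : H →ₗ[ℂ] H}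
    (hSinv₁ : ∀ x : H, Sinv (antipode ℂ x) = x)
    (hSinv₂ : ∀ x : H, antipode ℂ (Sinv x) = x) {aR bR : ι → H}
    (hRinv : IsUnit (∑ i, aR i ⊗ₜ[ℂ] bR i : H ⊗[ℂ] H))
    (hR₂ : (∑ i, aR i ⊗ₜ[ℂ] (comul (R := ℂ) (bR i)))
        = ∑ i, ∑ j, (aR i * aR j) ⊗ₜ[ℂ] (bR j ⊗ₜ[ℂ] bR i)) :
    (∑ i, aR i ⊗ₜ[ℂ] Sinv (bR i)) * (∑ i, aR i ⊗ₜ[ℂ] bR i) = 1 := by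
  have hcounit : ∑ i, counit (R := ℂ) (bR i) • aR i = 1 := by
    have h := congrArg (LinearMap.lTensor H ((TensorProduct.rid ℂ H).toLinearMap ∘ₗ
      LinearMap.lTensor H (counit (R := ℂ)))) hR₂
    have h' : (∑ i, aR i ⊗ₜ[ℂ] bR i)
        = ((∑ i, counit (R := ℂ) (bR i) • aR i) ⊗ₜ 1) * ∑ i, aR i ⊗ₜ[ℂ] bR i := by
      simpa [Finset.sum_mul_sum, TensorProduct.sum_tmul, ← smul_tmul'] using h
    have h₁ := hRinv.mul_right_cancel ((one_mul _).trans h')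
    simpa [Algebra.TensorProduct.one_def] using congrArg ((TensorProduct.rid ℂ H).toLinearMap ∘ₗ
      LinearMap.lTensor H (counit (R := ℂ))) h₁.symm
  have hflip (y : H) : (LinearMap.mul' ℂ H ∘ₗ (TensorProduct.comm ℂ H H).toLinearMap ∘ₗ
      LinearMap.lTensor H Sinv) (comul (R := ℂ) y) = counit (R := ℂ) y • 1 := by
    rw [← sum_antipodeInv_right_mul_left hSinv₁ hSinv₂, ← (ℛ ℂ y).eq]
    simp
  have h := congrArg (LinearMap.lTensor H (LinearMap.mul' ℂ H ∘ₗ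
    (TensorProduct.comm ℂ H H).toLinearMap ∘ₗ LinearMap.lTensor H Sinv)) hR₂
  simp only [map_sum, LinearMap.lTensor_tmul, hflip] at h
  simp only [LinearMap.comp_apply, LinearMap.lTensor_tmul, LinearEquiv.coe_coe,
    TensorProduct.comm_tmul, LinearMap.mul'_apply] at h
  simp only [Finset.sum_mul_sum, Algebra.TensorProduct.tmul_mul_tmul, ← h,
    ← smul_tmul, ← TensorProduct.sum_tmul, hcounit]
  rfl

lemma sum_antipode_tmul_eq_sum_tmul_antipodeInv {Sinv : H →ₗ[ℂ] H}
    (hSinv₁ : ∀ x : H, Sinv (antipode ℂ x) = x)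
    (hSinv₂ : ∀ x : H, antipode ℂ (Sinv x) = x) {aR bR : ι → H}
    (hRinv : IsUnit (∑ i, aR i ⊗ₜ[ℂ] bR i : H ⊗[ℂ] H))
    (hR₁ : (∑ i, (comul (R := ℂ) (aR i)) ⊗ₜ[ℂ] bR i)
        = ∑ i, ∑ j, (aR i ⊗ₜ[ℂ] aR j) ⊗ₜ[ℂ] (bR i * bR j))
    (hR₂ : (∑ i, aR i ⊗ₜ[ℂ] (comul (R := ℂ) (bR i)))
        = ∑ i, ∑ j, (aR i * aR j) ⊗ₜ[ℂ] (bR j ⊗ₜ[ℂ] bR i)) :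
    ∑ i, antipode ℂ (aR i) ⊗ₜ[ℂ] bR i = ∑ i, aR i ⊗ₜ[ℂ] Sinv (bR i) :=
  hRinv.mul_right_cancel <| (sum_antipode_tmul_mul_rMatrix hRinv hR₁).trans
    (sum_tmul_antipodeInv_mul_rMatrix hSinv₁ hSinv₂ hRinv hR₂).symm

lemma antipode_sum_eval_antipodeInv {Sinv : H →ₗ[ℂ] H}
    (hSinv₁ : ∀ x : H, Sinv (antipode ℂ x) = x)
    (hSinv₂ : ∀ x : H, antipode ℂ (Sinv x) = x) {aR bR : ι → H}
    (hR : ∑ i, antipode ℂ (aR i) ⊗ₜ[ℂ] bR i = ∑ i, aR i ⊗ₜ[ℂ] Sinv (bR i))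
    (γ : Module.Dual ℂ H) :
    antipode ℂ (∑ i, ∑ j, γ (Sinv (aR j) * bR i) • (antipode ℂ (aR i) * bR j))
      = antipode ℂ (antipode ℂ (∑ i, ∑ j, γ (aR i * bR j) • (bR i * aR j))) := by
  have hi (j : ι) : ∑ i, γ (Sinv (aR j) * bR i) • (antipode ℂ (aR i) * bR j)
      = ∑ i, γ (Sinv (aR j) * Sinv (bR i)) • (aR i * bR j) := by
    have h := congrArg (TensorProduct.lift (LinearMap.mk₂ ℂ
      (fun p q => γ (Sinv (aR j) * q) • (p * bR j)) (by simp [add_mul]) (by simp [smul_smul, mul_comm])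
      (by simp [mul_add, add_smul]) (by simp [mul_smul]))) hR
    simpa using h
  have hS : ∑ i, Sinv (aR i) ⊗ₜ[ℂ] antipode ℂ (bR i)
      = ∑ i, aR i ⊗ₜ[ℂ] antipode ℂ (antipode ℂ (bR i)) := by
    have h := congrArg (TensorProduct.map Sinv (antipode ℂ ∘ₗ antipode ℂ)) hR
    simpa [hSinv₁, hSinv₂] using h.symm
  have hj (i : ι) : ∑ j, γ (Sinv (aR j) * Sinv (bR i)) • (antipode ℂ (bR j) * antipode ℂ (aR i))
      = ∑ j, γ (aR j * Sinv (bR i)) •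
        (antipode ℂ (antipode ℂ (bR j)) * antipode ℂ (aR i)) := by
    have h := congrArg (TensorProduct.lift (LinearMap.mk₂ ℂ
      (fun p q => γ (p * Sinv (bR i)) • (q * antipode ℂ (aR i)))
      (by simp [add_mul, add_smul]) (by simp [mul_smul])
      (by simp [add_mul]) (by simp [smul_smul, mul_comm]))) hS
    simpa using h
  have hk (j : ι) : ∑ i, γ (aR j * Sinv (bR i)) •
        (antipode ℂ (antipode ℂ (bR j)) * antipode ℂ (aR i))
      = ∑ i, γ (aR j * bR i) •
        (antipode ℂ (antipode ℂ (bR j)) * antipode ℂ (antipode ℂ (aR i))) := by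
    have h := congrArg (TensorProduct.lift (LinearMap.mk₂ ℂ
      (fun p q => γ (aR j * q) • (antipode ℂ (antipode ℂ (bR j)) * antipode ℂ p))
      (by simp [mul_add]) (by simp [smul_smul, mul_comm])
      (by simp [mul_add, add_smul]) (by simp [mul_smul]))) hR
    simpa using h.symm
  rw [Finset.sum_comm]
  simp_rw [hi]
  simp only [map_sum, map_smul, antipode_mul_antidistrib]
  rw [Finset.sum_comm]
  simp_rw [hj]
  rw [Finset.sum_comm]
  simp_rw [hk]

end RMatrix

theorem drinfeldMap_phi_v
    {H : Type} [Ring H] [HopfAlgebra ℂ H] [FiniteDimensional ℂ H]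
    -- the antipode is invertible
    (Sinv : H →ₗ[ℂ] H)
    (hSinv₁ : ∀ x : H, Sinv (HopfAlgebra.antipode (R := ℂ) x) = x)
    (hSinv₂ : ∀ x : H, HopfAlgebra.antipode (R := ℂ) (Sinv x) = x)
    -- an invertible R-matrix `R = Σᵢ aᵢ ⊗ bᵢ`
    {ι : Type} [Fintype ι] (aR bR : ι → H)
    (hRinv : IsUnit (∑ i, aR i ⊗ₜ[ℂ] bR i : H ⊗[ℂ] H))
    -- `R Δ(x) = Δᵒᵖ(x) R`
    (hRΔ : ∀ x : H,
      (∑ i, aR i ⊗ₜ[ℂ] bR i) * Coalgebra.comul (R := ℂ) x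
        = (TensorProduct.comm ℂ H H) (Coalgebra.comul (R := ℂ) x)
            * ∑ i, aR i ⊗ₜ[ℂ] bR i)
    -- `(Δ ⊗ id)(R) = R₁₃ R₂₃`
    (hR₁ : (∑ i, (Coalgebra.comul (R := ℂ) (aR i)) ⊗ₜ[ℂ] bR i)
        = ∑ i, ∑ j, (aR i ⊗ₜ[ℂ] aR j) ⊗ₜ[ℂ] (bR i * bR j))
    -- `(id ⊗ Δ)(R) = R₁₃ R₁₂`
    (hR₂ : (∑ i, aR i ⊗ₜ[ℂ] (Coalgebra.comul (R := ℂ) (bR i)))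
        = ∑ i, ∑ j, (aR i * aR j) ⊗ₜ[ℂ] (bR j ⊗ₜ[ℂ] bR i))
    -- a ribbon element `v`
    (v vinv : H) (hv₁ : v * vinv = 1) (hv₂ : vinv * v = 1)
    (hvcentral : ∀ x : H, v * x = x * v)
    (hSv : HopfAlgebra.antipode (R := ℂ) v = v)
    (hεv : Coalgebra.counit (R := ℂ) v = 1)
    -- `Δ(v) = (R'R)⁻¹ (v ⊗ v)`, i.e. `R' R Δ(v) = v ⊗ v`
    (hΔv : (∑ i, bR i ⊗ₜ[ℂ] aR i) * ((∑ i, aR i ⊗ₜ[ℂ] bR i)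
            * Coalgebra.comul (R := ℂ) v) = v ⊗ₜ[ℂ] v)
    -- factorizability: `β ↦ (β ⊗ id)(RR')` is bijective
    (hfact : Function.Bijective fun β : Module.Dual ℂ H =>
        ∑ i, ∑ j, β (aR i * bR j) • (bR i * aR j))
    -- the pivotal element `g = u v⁻¹`, where `u = Σᵢ S(bᵢ) aᵢ` is the Drinfeld element;
    -- `g` is invertible, grouplike and implements `S²`
    (g gi : H)
    (hg : g = (∑ i, HopfAlgebra.antipode (R := ℂ) (bR i) * aR i) * vinv)
    (hgi₁ : g * gi = 1) (hgi₂ : gi * g = 1)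
    (hggrouplike : Coalgebra.comul (R := ℂ) g = g ⊗ₜ[ℂ] g)
    (hgS₂ : ∀ x : H,
      HopfAlgebra.antipode (R := ℂ) (HopfAlgebra.antipode (R := ℂ) x) * g = g * x)
    -- a left integral `μˡ` and the right integral `μʳ = μˡ ∘ S⁻¹`
    (μl μr : Module.Dual ℂ H) (hμl0 : μl ≠ 0)
    (hμl : ∀ x : H, (TensorProduct.rid ℂ H)
        ((LinearMap.lTensor H μl) (Coalgebra.comul (R := ℂ) x)) = μl x • (1 : H))
    (hμr : μr = μl ∘ₗ Sinv) :
    -- `μˡ(v) ≠ 0` and `μˡ(v⁻¹) ≠ 0`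
    μl v ≠ 0 ∧ μl vinv ≠ 0
    -- `D(φ_v) = v` where `φ_v = μˡ(v⁻¹)⁻¹ μˡ(g⁻¹v⁻¹ ?)`
    ∧ drinfeldMap aR bR g ((μl vinv)⁻¹ • (μl ∘ₗ LinearMap.mulLeft ℂ (gi * vinv))) = v
    -- `D(φ_{v⁻¹}) = v⁻¹` where `φ_{v⁻¹} = μˡ(v)⁻¹ μˡ(g⁻¹v ?)`
    ∧ drinfeldMap aR bR g ((μl v)⁻¹ • (μl ∘ₗ LinearMap.mulLeft ℂ (gi * v))) = vinv
    -- (1) `φ_v, φ_{v⁻¹} ∈ SLF(H)`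
    ∧ IsSLF ((μl vinv)⁻¹ • (μl ∘ₗ LinearMap.mulLeft ℂ (gi * vinv)))
    ∧ IsSLF ((μl v)⁻¹ • (μl ∘ₗ LinearMap.mulLeft ℂ (gi * v)))
    -- (2) `μʳ(gxy) = μʳ(gyx)` and `μˡ(g⁻¹xy) = μˡ(g⁻¹yx)`
    ∧ (∀ x y : H, μr (g * (x * y)) = μr (g * (y * x)))
    ∧ (∀ x y : H, μl (gi * (x * y)) = μl (gi * (y * x)))
    -- (3) `μʳ(xy) = μʳ(S²(y)x)` and `μˡ(xy) = μˡ(S⁻²(y)x)`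
    ∧ (∀ x y : H, μr (x * y)
        = μr (HopfAlgebra.antipode (R := ℂ) (HopfAlgebra.antipode (R := ℂ) y) * x))
    ∧ (∀ x y : H, μl (x * y) = μl (Sinv (Sinv y) * x)) := by
  set R : H ⊗[ℂ] H := ∑ i, aR i ⊗ₜ[ℂ] bR i with hRdef
  have hcommR : TensorProduct.comm ℂ H H R = ∑ i, bR i ⊗ₜ[ℂ] aR i := by simp [hRdef]
  have hcomm_mul (s t : H ⊗[ℂ] H) : TensorProduct.comm ℂ H H (s * t)
      = TensorProduct.comm ℂ H H s * TensorProduct.comm ℂ H H t :=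
    map_mul (Algebra.TensorProduct.comm ℂ H H) s t
  have hcomm_comm (s : H ⊗[ℂ] H) :
      TensorProduct.comm ℂ H H (TensorProduct.comm ℂ H H s) = s :=
    (TensorProduct.comm ℂ H H).symm_apply_apply s
  set M : H ⊗[ℂ] H := R * TensorProduct.comm ℂ H H R with hMdef
  have hMeval (β : Module.Dual ℂ H) :
      partialEval β M = ∑ i, ∑ j, β (aR i * bR j) • (bR i * aR j) := by
    simp [hMdef, hRdef, Finset.sum_mul_sum]
  have hM (y : H) : M * TensorProduct.comm ℂ H H (comul (R := ℂ) y)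
      = TensorProduct.comm ℂ H H (comul (R := ℂ) y) * M := by
    have h := congrArg (TensorProduct.comm ℂ H H) (hRΔ y)
    rw [hcomm_mul, hcomm_mul, hcomm_comm] at h
    rw [hMdef, mul_assoc, h, ← mul_assoc, hRΔ, mul_assoc]
  have hinj (β : Module.Dual ℂ H) (h : partialEval β M = 0) : β = 0 :=
    hfact.1 (by simpa [hMeval] using h)
  have hvinv_central (x : H) : vinv * x = x * vinv := by
    calc vinv * x = vinv * (x * v) * vinv := by rw [mul_assoc, mul_assoc, hv₁, mul_one]
      _ = x * vinv := by rw [← hvcentral, ← mul_assoc, hv₂, one_mul]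
  -- `D̂(μˡ(v⁻¹ ?)) = μˡ(v⁻¹) v`
  have hM_comul_v : M * TensorProduct.comm ℂ H H (comul (R := ℂ) v) = v ⊗ₜ v := by
    have h := congrArg (TensorProduct.comm ℂ H H) hΔv
    rw [← hcommR, hcomm_mul, hcomm_mul, hcomm_comm] at h
    rwa [hMdef, mul_assoc]
  have hcomul_vinv : (1 ⊗ₜ v) * TensorProduct.comm ℂ H H (comul (R := ℂ) vinv)
      = (vinv ⊗ₜ 1) * M := by
    have hc : TensorProduct.comm ℂ H H (comul (R := ℂ) v)
        * TensorProduct.comm ℂ H H (comul (R := ℂ) vinv) = 1 := by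
      rw [← hcomm_mul, ← Bialgebra.comul_mul, hv₁, Bialgebra.comul_one]
      rfl
    calc _ = (vinv ⊗ₜ 1) * ((v ⊗ₜ v) * TensorProduct.comm ℂ H H (comul (R := ℂ) vinv)) := by
          rw [← mul_assoc, Algebra.TensorProduct.tmul_mul_tmul, hv₂, one_mul]
      _ = _ := by rw [← hM_comul_v, mul_assoc M, hc, mul_one]
  have hμl_comm (x : H) : partialEval μl (TensorProduct.comm ℂ H H (comul (R := ℂ) x))
      = μl x • 1 := by
    rw [← hμl x]
    generalize comul (R := ℂ) x = t
    induction t with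
    | zero => simp
    | tmul p q => simp
    | add s t hs ht => simp only [map_add, hs, ht]
  have heval_mulLeft (a : H) (t : H ⊗[ℂ] H) :
      partialEval (μl ∘ₗ LinearMap.mulLeft ℂ a) t = partialEval μl ((a ⊗ₜ 1) * t) := by
    induction t with
    | zero => simp
    | tmul p q => simp
    | add s t hs ht => simp only [map_add, mul_add, hs, ht]
  have hD_vinv : partialEval (μl ∘ₗ LinearMap.mulLeft ℂ vinv) M = μl vinv • v := by
    rw [heval_mulLeft, ← hcomul_vinv, partialEval_one_tmul_mul, hμl_comm, mul_smul_comm,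
      mul_one]
  have hne (a b : H) (hab : a * b = 1) (h : μl ∘ₗ LinearMap.mulLeft ℂ a = 0) : False :=
    hμl0 (LinearMap.ext fun x => by simpa [← mul_assoc, hab] using LinearMap.congr_fun h (b * x))
  have hμvinv : μl vinv ≠ 0 := fun h =>
    hne vinv v hv₂ (hinj _ (by rw [hD_vinv, h, zero_smul]))
  -- the trace property of the left integral
  have htwist (x y : H) : μl (x * y) = μl (Sinv (Sinv y) * x) := by
    have h := eval_mul_of_central hSinv₁ hSinv₂ M hM hinj (μl ∘ₗ LinearMap.mulLeft ℂ vinv)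
      (fun y => by rw [hD_vinv, smul_mul_assoc, mul_smul_comm, hvcentral]) (v * x) y
    simp only [LinearMap.comp_apply, LinearMap.mulLeft_apply] at h
    rwa [← mul_assoc, ← mul_assoc, hv₂, one_mul, ← mul_assoc, hvinv_central, mul_assoc,
      ← mul_assoc vinv, hv₂, one_mul] at h
  have hSinv_sq (y : H) : y * g = g * Sinv (Sinv y) := by
    simpa [hSinv₂] using hgS₂ (Sinv (Sinv y))
  have hsymm (x y : H) : μl (gi * (x * y)) = μl (gi * (y * x)) := by
    rw [← mul_assoc, htwist, ← one_mul (Sinv (Sinv y)), ← hgi₂, mul_assoc gi, ← hSinv_sq]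
    simp only [mul_assoc]
    rw [← mul_assoc g gi, hgi₁, one_mul]
  have hslf (w : H) (hw : ∀ x, w * x = x * w) (c : ℂ) :
      IsSLF (c • (μl ∘ₗ LinearMap.mulLeft ℂ (gi * w))) := by
    intro x y
    have h := hsymm (w * x) y
    rw [← mul_assoc y, ← hw y] at h
    simpa [mul_assoc] using congrArg (c * ·) h
  have hDrinfeld (w : H) (hw : ∀ x, w * x = x * w) (c : ℂ) :
      drinfeldMap aR bR g (c • (μl ∘ₗ LinearMap.mulLeft ℂ (gi * w)))
        = c • partialEval (μl ∘ₗ LinearMap.mulLeft ℂ w) M := by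
    have hgw (x : H) : gi * w * (g * x) = w * x := by
      rw [mul_assoc, ← mul_assoc w, hw g, mul_assoc, ← mul_assoc, hgi₂, one_mul]
    simp only [drinfeldMap, hMeval, LinearMap.smul_apply, LinearMap.comp_apply,
      LinearMap.mulLeft_apply, hgw, Finset.smul_sum, smul_eq_mul, mul_smul]
  -- `D̂(μˡ(v ?)) = μˡ(v) v⁻¹`
  have hRS := sum_antipode_tmul_eq_sum_tmul_antipodeInv hSinv₁ hSinv₂ hRinv hR₁ hR₂
  have hX := sum_antipode_tmul_mul_rMatrix hRinv hR₁
  have hX' : (∑ i, bR i ⊗ₜ[ℂ] antipode ℂ (aR i)) * (∑ i, bR i ⊗ₜ[ℂ] aR i) = 1 := by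
    have h := congrArg (TensorProduct.comm ℂ H H) hX
    rw [hcomm_mul, hcommR] at h
    simpa [Algebra.TensorProduct.one_def] using h
  have hcomul_v : comul (R := ℂ) v = (∑ i, antipode ℂ (aR i) ⊗ₜ[ℂ] bR i) *
      ((∑ i, bR i ⊗ₜ[ℂ] antipode ℂ (aR i)) * (v ⊗ₜ v)) := by
    rw [← hΔv, ← mul_assoc (∑ i, bR i ⊗ₜ[ℂ] antipode ℂ (aR i)), hX', one_mul, ← mul_assoc, hX,
      one_mul]
  set γ : Module.Dual ℂ H := μl ∘ₗ LinearMap.mulLeft ℂ v with hγ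
  have hinner : ∑ i, ∑ j, γ (Sinv (aR j) * bR i) • (antipode ℂ (aR i) * bR j)
      = μl v • vinv := by
    have h := hμl v
    rw [hcomul_v, ← mul_assoc, Finset.sum_mul_sum] at h
    simp only [Finset.sum_mul, Algebra.TensorProduct.tmul_mul_tmul, map_sum,
      LinearMap.lTensor_tmul, TensorProduct.rid_tmul] at h
    have hterm (i j : ι) : μl (bR i * antipode ℂ (aR j) * v) = γ (Sinv (aR j) * bR i) := by
      rw [← hvcentral, ← mul_assoc, htwist, hSinv₁, ← mul_assoc, ← hvcentral, mul_assoc]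
      rfl
    simp only [hterm] at h
    have h' := congrArg (· * vinv) h
    simpa [Finset.sum_mul, mul_assoc, hv₁] using h'
  have hSvinv : antipode ℂ vinv = vinv := by
    have h := antipode_mul_antidistrib (R := ℂ) vinv v
    rw [hv₂, antipode_one, hSv] at h
    rw [← one_mul (antipode ℂ vinv), ← hv₂, mul_assoc, ← h, mul_one]
  have hD_v : partialEval γ M = μl v • vinv := by
    have h := antipode_sum_eval_antipodeInv hSinv₁ hSinv₂ hRS γ
    rw [hinner, ← hMeval] at h
    have h' := congrArg (fun x => Sinv (Sinv x)) h
    simp only [hSinv₁] at h'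
    rw [← h', map_smul, ← hSvinv, hSinv₁, hSvinv]
  have hμv : μl v ≠ 0 := fun h => hne v vinv hv₁ (hinj _ (by rw [← hγ, hD_v, h, zero_smul]))
  have hεg : counit (R := ℂ) g • (1 : H) = 1 := by
    have h := congrArg (TensorProduct.lid ℂ H) (rTensor_counit_comul (R := ℂ) g)
    rw [hggrouplike, LinearMap.rTensor_tmul, TensorProduct.lid_tmul, TensorProduct.lid_tmul,
      one_smul] at h
    rw [← hgi₁, ← smul_mul_assoc, h]
  have hSg : antipode ℂ g = gi := by
    have h := mul_antipode_rTensor_comul_apply (R := ℂ) g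
    rw [hggrouplike, LinearMap.rTensor_tmul, LinearMap.mul'_apply,
      Algebra.algebraMap_eq_smul_one, hεg] at h
    rw [← mul_one (antipode ℂ g), ← hgi₁, ← mul_assoc, h, one_mul]
  have hSinv_gi : Sinv gi = g := by rw [← hSg, hSinv₁]
  have hSinv_g : Sinv g = gi := by
    have h := antipodeInv_mul hSinv₁ hSinv₂ g gi
    rw [hgi₁, antipodeInv_one hSinv₁, hSinv_gi] at h
    rw [← one_mul (Sinv g), ← hgi₂, mul_assoc, ← h, mul_one]
  refine ⟨hμv, hμvinv, ?_, ?_, hslf _ hvinv_central _, hslf _ hvcentral _, ?_, hsymm, ?_, htwist⟩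
  · rw [hDrinfeld _ hvinv_central, hD_vinv, smul_smul, inv_mul_cancel₀ hμvinv, one_smul]
  · rw [hDrinfeld _ hvcentral, ← hγ, hD_v, smul_smul, inv_mul_cancel₀ hμv, one_smul]
  · intro x y
    simp only [hμr, LinearMap.comp_apply, antipodeInv_mul hSinv₁ hSinv₂, hSinv_g]
    rw [htwist _ gi, htwist _ gi, hSinv_gi, hSinv_g, hsymm]
  · intro x y
    simp only [hμr, LinearMap.comp_apply, antipodeInv_mul hSinv₁ hSinv₂, hSinv₁]
    rw [htwist (Sinv x), hSinv₁]

end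
end

section
/- H is unibalanced: with μ^r = μ^l ∘ S^{-1}, one has μ^l(x) = μ^r(g² x) for all x ∈ H. -/
/- STATEMENT 2: `H` is unibalanced: `μˡ(x) = μʳ(g² x)` for all `x`. -/

noncomputable section

open scoped TensorProduct
open TensorProduct

section Integral

open Coalgebra HopfAlgebra

variable {K H : Type*} [Field K] [Ring H] [HopfAlgebra K H]

lemma sum_counit_right_smul_left {ι : Type*} {x : H} (r : Repr K x ι) :
    ∑ i ∈ r.index, counit (R := K) (r.right i) • r.left i = x := by
  simpa [-sum_tmul_counit_eq] using congr(TensorProduct.rid K H $(sum_tmul_counit_eq r))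

/-- `μ` is a left integral on `H`: `(id ⊗ μ)(Δ x) = μ x • 1` for all `x`. -/
def IsLeftIntegral (μ : Module.Dual K H) : Prop :=
  ∀ x : H, TensorProduct.rid K H (μ.lTensor H (comul x)) = μ x • (1 : H)

/-- `S(x') x'' ⊗ x''' = 1 ⊗ x`. -/
lemma sum_antipode_tmul_one_mul_comul {ι : Type*} {x : H} (r : Repr K x ι) :
    ∑ i ∈ r.index, (antipode K (r.left i) ⊗ₜ[K] (1 : H)) * comul (r.right i) = 1 ⊗ₜ x := by
  have h := congr((LinearMap.mul' K H ∘ₗ (antipode K).rTensor H).rTensor H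
    ((TensorProduct.assoc K H H H).symm
      $(sum_tmul_tmul_eq r (fun i ↦ ℛ K (r.left i)) (fun i ↦ ℛ K (r.right i)))))
  simp only [map_sum, TensorProduct.assoc_symm_tmul, LinearMap.rTensor_tmul, LinearMap.comp_apply,
    LinearMap.mul'_apply, ← TensorProduct.sum_tmul, sum_antipode_mul_eq_smul,
    TensorProduct.smul_tmul] at h
  rw [← TensorProduct.tmul_sum, sum_counit_smul] at h
  rw [h]
  refine Finset.sum_congr rfl fun i _ ↦ ?_
  rw [← (ℛ K (r.right i)).eq, Finset.mul_sum]
  simp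

/-- `y' μ(x y'') = S(x') μ(x'' y)` for a left integral `μ`. -/
lemma IsLeftIntegral.sum_mul_right_smul_left {ι κ : Type*} {μ : Module.Dual K H}
    (hμ : IsLeftIntegral μ) {x y : H} (r : Repr K x ι) (s : Repr K y κ) :
    ∑ j ∈ s.index, μ (x * s.right j) • s.left j =
      ∑ i ∈ r.index, μ (r.right i * y) • antipode K (r.left i) := by
  have hmul (a : H) (t : H ⊗[K] H) : TensorProduct.rid K H (μ.lTensor H ((a ⊗ₜ 1) * t)) =
      a * TensorProduct.rid K H (μ.lTensor H t) := by
    induction t with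
    | zero => simp
    | tmul b c => simp
    | add b c hb hc => simp [mul_add, hb, hc]
  have h := congr(TensorProduct.rid K H (μ.lTensor H
    ($(sum_antipode_tmul_one_mul_comul r) * comul y)))
  simp only [Finset.sum_mul, map_sum, mul_assoc, ← Bialgebra.comul_mul, hmul, hμ _] at h
  rw [← s.eq, Finset.mul_sum] at h
  simpa using h.symm

variable [FiniteDimensional K H]

/-- The form `(x, y) ↦ μ (x y)` of a nonzero left integral `μ` is nondegenerate. -/
lemma IsLeftIntegral.eq_zero_of_forall_mul_eq_zero {μ : Module.Dual K H}
    (hμ : IsLeftIntegral μ) (hμ0 : μ ≠ 0) {y : H} (hy : ∀ x, μ (x * y) = 0) : y = 0 := by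
  let b := Module.finBasis K H
  have hrepr (z : H) (hz : ∀ x, μ (x * z) = 0) :
      ∃ s : Repr K z (Fin (Module.finrank K H)), ∀ k x, μ (x * s.right k) = 0 := by
    obtain ⟨c, hc⟩ := TensorProduct.eq_repr_basis_left b (comul (R := K) z)
    refine ⟨⟨Finset.univ, b, c, ?_⟩, fun k x ↦ ?_⟩
    · rw [← hc, Finsupp.sum_fintype _ _ (by simp)]
    · have h := hμ.sum_mul_right_smul_left (x := x) (ℛ K x)
        ⟨Finset.univ, b, c, by rw [← hc, Finsupp.sum_fintype _ _ (by simp)]⟩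
      simp only [hz, zero_smul, Finset.sum_const_zero] at h
      exact Fintype.linearIndependent_iff.mp b.linearIndependent _ h k
  have hcounit (z : H) (hz : ∀ x, μ (x * z) = 0) : counit (R := K) z = 0 := by
    obtain ⟨s, hs⟩ := hrepr z hz
    obtain ⟨w, hw⟩ := DFunLike.ne_iff.mp hμ0
    have h := congr(μ (w * $(sum_antipode_mul_eq_smul s)))
    simp only [Finset.mul_sum, ← mul_assoc, map_sum, hs, Finset.sum_const_zero, mul_smul_comm,
      mul_one, map_smul, smul_eq_mul] at h
    exact (mul_eq_zero.mp h.symm).resolve_right hw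
  obtain ⟨s, hs⟩ := hrepr y hy
  have h := sum_tmul_counit_eq s
  simp only [hcounit _ (hs _), TensorProduct.tmul_zero, Finset.sum_const_zero] at h
  simpa using congr(TensorProduct.rid K H $h.symm)

/-- A nonzero left integral has a left cointegral normalised by `μ Λ = 1`. -/
lemma IsLeftIntegral.exists_leftCointegral {μ : Module.Dual K H}
    (hμ : IsLeftIntegral μ) (hμ0 : μ ≠ 0) :
    ∃ Λ : H, μ Λ = 1 ∧ (∀ x, μ (x * Λ) = counit (R := K) x) ∧
      ∀ x, x * Λ = counit (R := K) x • Λ := by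
  let f : H →ₗ[K] Module.Dual K H := (LinearMap.mul K H).flip.compr₂ μ
  have hf : Function.Injective f := (injective_iff_map_eq_zero f).mpr fun y hy ↦
    hμ.eq_zero_of_forall_mul_eq_zero hμ0 fun x ↦ congr($hy x)
  obtain ⟨Λ, hΛ⟩ := (LinearMap.injective_iff_surjective_of_finrank_eq_finrank
    Subspace.dual_finrank_eq.symm).mp hf (counit (R := K))
  have hΛ' (x : H) : μ (x * Λ) = counit (R := K) x := congr($hΛ x)
  refine ⟨Λ, by simpa using hΛ' 1, hΛ', fun x ↦ ?_⟩
  refine sub_eq_zero.mp (hμ.eq_zero_of_forall_mul_eq_zero hμ0 fun y ↦ ?_)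
  simp [mul_sub, ← mul_assoc, hΛ', mul_comm]

/-- For a left cointegral `Λ` normalised by `μ Λ = 1`, right multiplication on `Λ` is given by the
character `x ↦ μ (Λ x)`. -/
lemma IsLeftIntegral.leftCointegral_mul {μ : Module.Dual K H}
    (hμ : IsLeftIntegral μ) (hμ0 : μ ≠ 0) {Λ : H} (hμΛ : μ Λ = 1)
    (hΛ : ∀ x, x * Λ = counit (R := K) x • Λ) (x : H) : Λ * x = μ (Λ * x) • Λ := by
  refine sub_eq_zero.mp (hμ.eq_zero_of_forall_mul_eq_zero hμ0 fun y ↦ ?_)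
  simp [mul_sub, ← mul_assoc, hΛ, hμΛ, mul_comm]

omit [FiniteDimensional K H]

/-- A central element `v` fixed by the antipode satisfies `v' μ(Λ v'') = v`. -/
lemma IsLeftIntegral.rid_lTensor_comul_of_central {μ : Module.Dual K H}
    (hμ : IsLeftIntegral μ) {Λ : H} (hΛ : ∀ x, μ (x * Λ) = counit (R := K) x)
    {v : H} (hv : ∀ x, v * x = x * v) (hSv : antipode K v = v) :
    TensorProduct.rid K H ((μ ∘ₗ LinearMap.mulLeft K Λ).lTensor H (comul v)) = v := by
  have h₁ := hμ.sum_mul_right_smul_left (ℛ K Λ) (ℛ K v)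
  have h₂ := hμ.sum_mul_right_smul_left (ℛ K v) (ℛ K Λ)
  have h₃ := congr(antipode K (antipode K $(sum_counit_right_smul_left (ℛ K v))))
  simp only [map_sum, map_smul, hSv] at h₃
  replace h₂ := congr(antipode K $h₂)
  simp only [hΛ, map_sum, map_smul, hv, h₃] at h₂
  rw [h₂] at h₁
  conv_lhs => rw [← (ℛ K v).eq]
  simpa using h₁

/-- `S(h) Λ' ⊗ Λ'' = Λ' ⊗ h Λ''` for a left cointegral `Λ`. -/
lemma antipode_tmul_one_mul_comul_leftCointegral {Λ : H}
    (hΛ : ∀ x, x * Λ = counit (R := K) x • Λ) (h : H) :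
    (antipode K h ⊗ₜ[K] (1 : H)) * comul Λ = (1 ⊗ₜ h) * comul Λ := by
  have h' := congr((antipode K $(sum_counit_right_smul_left (ℛ K h)) ⊗ₜ[K] (1 : H)) * comul Λ)
  simp only [map_sum, map_smul, TensorProduct.sum_tmul, ← TensorProduct.smul_tmul', Finset.sum_mul,
    smul_mul_assoc] at h'
  rw [← h', ← sum_antipode_tmul_one_mul_comul (ℛ K h), Finset.sum_mul]
  simp only [mul_assoc, ← Bialgebra.comul_mul, hΛ, map_smul, mul_smul_comm]

end Integral

section RMatrix

open Coalgebra HopfAlgebra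

variable {K H ι : Type*} [Field K] [Ring H] [HopfAlgebra K H] [Fintype ι] {a b : ι → H}

/-- A character `χ` whose translation action fixes the ribbon element is sent to `1` by the
Drinfeld map. -/
lemma sum_sum_character_smul_eq_one {v vinv : H} (hv : v * vinv = 1)
    (hεv : counit (R := K) v = 1)
    (hΔv : (∑ i, b i ⊗ₜ[K] a i) * ((∑ i, a i ⊗ₜ[K] b i) * comul (R := K) v) = v ⊗ₜ[K] v)
    (χ : H →ₐ[K] K) (hχ : TensorProduct.rid K H (χ.toLinearMap.lTensor H (comul v)) = v) :
    ∑ i, ∑ j, χ (a i * b j) • (b i * a j) = 1 := by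
  let F : H ⊗[K] H →ₐ[K] H :=
    (Algebra.TensorProduct.rid K K H).toAlgHom.comp (Algebra.TensorProduct.map (.id K H) χ)
  have hF (x y : H) : F (x ⊗ₜ y) = χ y • x := by simp [F]
  have hFv : F (comul v) = v := hχ
  have hχv : χ v = 1 := by
    have h₁ := congr(χ $(sum_counit_smul (ℛ K v)))
    have h₂ := congr(counit (R := K) (F $((ℛ K v).eq)))
    simp only [map_sum, hF, map_smul, hFv, hεv, smul_eq_mul] at h₁ h₂
    rw [← h₁, ← h₂]
    exact Finset.sum_congr rfl fun i _ ↦ mul_comm _ _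
  have h := congr(F ($hΔv) * vinv)
  simp only [map_mul, hFv, hF, map_sum, hχv, one_smul, mul_assoc, hv, mul_one] at h
  simpa [Finset.sum_mul_sum, smul_smul, mul_comm] using h

lemma sum_counit_smul_right_eq_one (hR : IsUnit (∑ i, a i ⊗ₜ[K] b i : H ⊗[K] H))
    (hR₁ : (∑ i, (comul (R := K) (a i)) ⊗ₜ[K] b i)
        = ∑ i, ∑ j, (a i ⊗ₜ[K] a j) ⊗ₜ[K] (b i * b j)) :
    ∑ i, counit (R := K) (a i) • b i = 1 := by
  have h := congr(((TensorProduct.lid K H).toLinearMap ∘ₗ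
    (counit (R := K) (A := H)).rTensor H).rTensor H $hR₁)
  simp only [map_sum, LinearMap.rTensor_tmul, LinearMap.comp_apply, rTensor_counit_comul,
    LinearEquiv.coe_coe, TensorProduct.lid_tmul, one_smul] at h
  have h' : (1 ⊗ₜ (∑ i, counit (R := K) (a i) • b i)) * ∑ i, a i ⊗ₜ[K] b i =
      1 * ∑ i, a i ⊗ₜ[K] b i := by
    conv_rhs => rw [one_mul, h]
    rw [TensorProduct.tmul_sum, Finset.sum_mul_sum]
    simp [← TensorProduct.smul_tmul']
  simpa [Algebra.TensorProduct.one_def] using congr(TensorProduct.lid K H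
    ((counit (R := K) (A := H)).rTensor H $(hR.mul_right_cancel h')))

lemma sum_counit_smul_left_eq_one (hR : IsUnit (∑ i, a i ⊗ₜ[K] b i : H ⊗[K] H))
    (hR₂ : (∑ i, a i ⊗ₜ[K] (comul (R := K) (b i)))
        = ∑ i, ∑ j, (a i * a j) ⊗ₜ[K] (b j ⊗ₜ[K] b i)) :
    ∑ i, counit (R := K) (b i) • a i = 1 := by
  have h := congr(((TensorProduct.lid K H).toLinearMap ∘ₗ
    (counit (R := K) (A := H)).rTensor H).lTensor H $hR₂)
  simp only [map_sum, LinearMap.lTensor_tmul, LinearMap.comp_apply, rTensor_counit_comul,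
    LinearMap.rTensor_tmul, LinearEquiv.coe_coe, TensorProduct.lid_tmul, one_smul] at h
  have h' : (∑ i, a i ⊗ₜ[K] b i) * ((∑ i, counit (R := K) (b i) • a i) ⊗ₜ 1) =
      (∑ i, a i ⊗ₜ[K] b i) * 1 := by
    conv_rhs => rw [mul_one, h]
    rw [TensorProduct.sum_tmul, Finset.sum_mul_sum]
    simp [← TensorProduct.smul_tmul']
  simpa [Algebra.TensorProduct.one_def] using congr(TensorProduct.rid K H
    ((counit (R := K) (A := H)).lTensor H $(hR.mul_left_cancel h')))

variable {Sinv : H →ₗ[K] H}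

lemma mul'_comm_rTensor_comul (hS₁ : ∀ x, Sinv (antipode K x) = x)
    (hS₂ : ∀ x, antipode K (Sinv x) = x) (x : H) :
    LinearMap.mul' K H (TensorProduct.comm K H H (Sinv.rTensor H (comul x))) =
      algebraMap K H (counit x) := by
  have h (t : H ⊗[K] H) :
      antipode K (LinearMap.mul' K H (TensorProduct.comm K H H (Sinv.rTensor H t))) =
        LinearMap.mul' K H ((antipode K).lTensor H t) := by
    induction t with
    | zero => simp
    | tmul y z => simp [antipode_mul_antidistrib, hS₂]
    | add y z hy hz => simp [hy, hz]
  refine (Function.LeftInverse.injective hS₁) ?_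
  rw [h, mul_antipode_lTensor_comul_apply]
  simp [Algebra.algebraMap_eq_smul_one]

/-- The R-matrix is invariant under `S ⊗ S`. -/
lemma sum_antipode_tmul_antipode (hS₁ : ∀ x, Sinv (antipode K x) = x)
    (hS₂ : ∀ x, antipode K (Sinv x) = x)
    (hR : IsUnit (∑ i, a i ⊗ₜ[K] b i : H ⊗[K] H))
    (hR₁ : (∑ i, (comul (R := K) (a i)) ⊗ₜ[K] b i)
        = ∑ i, ∑ j, (a i ⊗ₜ[K] a j) ⊗ₜ[K] (b i * b j))
    (hR₂ : (∑ i, a i ⊗ₜ[K] (comul (R := K) (b i)))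
        = ∑ i, ∑ j, (a i * a j) ⊗ₜ[K] (b j ⊗ₜ[K] b i)) :
    ∑ i, antipode K (a i) ⊗ₜ[K] antipode K (b i) = ∑ i, a i ⊗ₜ[K] b i := by
  have hleft : (∑ i, antipode K (a i) ⊗ₜ[K] b i) * (∑ i, a i ⊗ₜ[K] b i) = 1 := by
    have h := congr((LinearMap.mul' K H ∘ₗ (antipode K).rTensor H).rTensor H $hR₁)
    simp only [map_sum, LinearMap.rTensor_tmul, LinearMap.comp_apply,
      mul_antipode_rTensor_comul_apply, Algebra.algebraMap_eq_smul_one, TensorProduct.smul_tmul,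
      ← TensorProduct.tmul_sum, sum_counit_smul_right_eq_one hR hR₁, LinearMap.mul'_apply] at h
    rw [Algebra.TensorProduct.one_def, h, Finset.sum_mul_sum]
    simp
  have hright : (∑ i, a i ⊗ₜ[K] b i) * (∑ i, a i ⊗ₜ[K] Sinv (b i)) = 1 := by
    have h := congr((LinearMap.mul' K H ∘ₗ (TensorProduct.comm K H H).toLinearMap ∘ₗ
      Sinv.rTensor H).lTensor H $hR₂)
    simp only [map_sum, LinearMap.lTensor_tmul, LinearMap.comp_apply, LinearEquiv.coe_coe,
      mul'_comm_rTensor_comul hS₁ hS₂, Algebra.algebraMap_eq_smul_one, ← TensorProduct.smul_tmul,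
      ← TensorProduct.sum_tmul, sum_counit_smul_left_eq_one hR hR₂, LinearMap.rTensor_tmul,
      TensorProduct.comm_tmul, LinearMap.mul'_apply] at h
    rw [Algebra.TensorProduct.one_def, h, Finset.sum_mul_sum]
    simp
  have h := congr((antipode K).lTensor H $(left_inv_eq_right_inv hleft hright))
  simpa [hS₂] using h

/-- For a left integral `μ` and a two-sided cointegral `Λ` with `μ Λ = 1`, the antipode of
`μ(Λ') Λ''` intertwines `S(u)` and the Drinfeld element `u`. -/
lemma IsLeftIntegral.antipode_lid_rTensor_comul_mul (hS₁ : ∀ x, Sinv (antipode K x) = x)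
    (hS₂ : ∀ x, antipode K (Sinv x) = x)
    (hR : IsUnit (∑ i, a i ⊗ₜ[K] b i : H ⊗[K] H))
    (hRΔ : ∀ x : H, (∑ i, a i ⊗ₜ[K] b i) * comul (R := K) x =
      TensorProduct.comm K H H (comul (R := K) x) * ∑ i, a i ⊗ₜ[K] b i)
    (hR₁ : (∑ i, (comul (R := K) (a i)) ⊗ₜ[K] b i)
        = ∑ i, ∑ j, (a i ⊗ₜ[K] a j) ⊗ₜ[K] (b i * b j))
    (hR₂ : (∑ i, a i ⊗ₜ[K] (comul (R := K) (b i)))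
        = ∑ i, ∑ j, (a i * a j) ⊗ₜ[K] (b j ⊗ₜ[K] b i))
    {μ : Module.Dual K H} (hμ : IsLeftIntegral μ) {Λ : H}
    (hΛ : ∀ x, x * Λ = counit (R := K) x • Λ)
    (hμΛ : ∀ x, μ (Λ * x) = counit (R := K) x) :
    antipode K (TensorProduct.lid K H (μ.rTensor H (comul Λ))) *
        antipode K (∑ i, antipode K (b i) * a i) = ∑ i, antipode K (b i) * a i := by
  set A := TensorProduct.lid K H (μ.rTensor H (comul Λ)) with hA
  have hleft (x y : H) (t : H ⊗[K] H) :
      TensorProduct.lid K H (μ.rTensor H ((x ⊗ₜ y) * t)) =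
        y * TensorProduct.lid K H (μ.rTensor H ((x ⊗ₜ 1) * t)) := by
    induction t with
    | zero => simp
    | tmul c d => simp
    | add c d hc hd => simp [mul_add, hc, hd]
  have hC (x : H) : TensorProduct.lid K H (μ.rTensor H ((x ⊗ₜ 1) * comul Λ)) = Sinv x * A := by
    have h := antipode_tmul_one_mul_comul_leftCointegral hΛ (Sinv x)
    rw [hS₂] at h
    rw [h, hleft, ← Algebra.TensorProduct.one_def, one_mul]
  have hright (x y : H) : antipode K (TensorProduct.lid K H
      (μ.rTensor H (TensorProduct.comm K H H (comul Λ) * (x ⊗ₜ y)))) = antipode K y * x := by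
    have h := hμ.sum_mul_right_smul_left (ℛ K Λ) (ℛ K x)
    simp only [hμΛ, sum_counit_right_smul_left] at h
    conv_rhs => rw [h]
    rw [← (ℛ K Λ).eq]
    simp [Finset.sum_mul, Finset.mul_sum, antipode_mul_antidistrib]
  have h := congr(antipode K (TensorProduct.lid K H (μ.rTensor H $(hRΔ Λ))))
  rw [Finset.sum_mul, Finset.mul_sum] at h
  simp only [map_sum, hright] at h
  simp only [hleft (a _) (b _), hC, antipode_mul_antidistrib, hS₂, mul_assoc,
    ← Finset.mul_sum] at h
  have hSS := congr(LinearMap.mul' K H ((antipode K).lTensor H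
    $(sum_antipode_tmul_antipode hS₁ hS₂ hR hR₁ hR₂)))
  simp only [map_sum, LinearMap.lTensor_tmul, LinearMap.mul'_apply] at hSS
  rw [← hSS] at h
  simpa [antipode_mul_antidistrib] using h

end RMatrix

theorem unibalanced
    {H : Type} [Ring H] [HopfAlgebra ℂ H] [FiniteDimensional ℂ H]
    -- the antipode is invertible
    (Sinv : H →ₗ[ℂ] H)
    (hSinv₁ : ∀ x : H, Sinv (HopfAlgebra.antipode (R := ℂ) x) = x)
    (hSinv₂ : ∀ x : H, HopfAlgebra.antipode (R := ℂ) (Sinv x) = x)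
    -- an invertible R-matrix `R = Σᵢ aᵢ ⊗ bᵢ`
    {ι : Type} [Fintype ι] (aR bR : ι → H)
    (hRinv : IsUnit (∑ i, aR i ⊗ₜ[ℂ] bR i : H ⊗[ℂ] H))
    -- `R Δ(x) = Δᵒᵖ(x) R`
    (hRΔ : ∀ x : H,
      (∑ i, aR i ⊗ₜ[ℂ] bR i) * Coalgebra.comul (R := ℂ) x
        = (TensorProduct.comm ℂ H H) (Coalgebra.comul (R := ℂ) x)
            * ∑ i, aR i ⊗ₜ[ℂ] bR i)
    -- `(Δ ⊗ id)(R) = R₁₃ R₂₃`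
    (hR₁ : (∑ i, (Coalgebra.comul (R := ℂ) (aR i)) ⊗ₜ[ℂ] bR i)
        = ∑ i, ∑ j, (aR i ⊗ₜ[ℂ] aR j) ⊗ₜ[ℂ] (bR i * bR j))
    -- `(id ⊗ Δ)(R) = R₁₃ R₁₂`
    (hR₂ : (∑ i, aR i ⊗ₜ[ℂ] (Coalgebra.comul (R := ℂ) (bR i)))
        = ∑ i, ∑ j, (aR i * aR j) ⊗ₜ[ℂ] (bR j ⊗ₜ[ℂ] bR i))
    -- a ribbon element `v`
    (v vinv : H) (hv₁ : v * vinv = 1) (hv₂ : vinv * v = 1)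
    (hvcentral : ∀ x : H, v * x = x * v)
    (hSv : HopfAlgebra.antipode (R := ℂ) v = v)
    (hεv : Coalgebra.counit (R := ℂ) v = 1)
    -- `Δ(v) = (R'R)⁻¹ (v ⊗ v)`, i.e. `R' R Δ(v) = v ⊗ v`
    (hΔv : (∑ i, bR i ⊗ₜ[ℂ] aR i) * ((∑ i, aR i ⊗ₜ[ℂ] bR i)
            * Coalgebra.comul (R := ℂ) v) = v ⊗ₜ[ℂ] v)
    -- factorizability: `β ↦ (β ⊗ id)(RR')` is bijective
    (hfact : Function.Bijective fun β : Module.Dual ℂ H =>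
        ∑ i, ∑ j, β (aR i * bR j) • (bR i * aR j))
    -- the pivotal element `g = u v⁻¹`, where `u = Σᵢ S(bᵢ) aᵢ` is the Drinfeld element;
    -- `g` is invertible, grouplike and implements `S²`
    (g gi : H)
    (hg : g = (∑ i, HopfAlgebra.antipode (R := ℂ) (bR i) * aR i) * vinv)
    (hgi₁ : g * gi = 1) (hgi₂ : gi * g = 1)
    (hggrouplike : Coalgebra.comul (R := ℂ) g = g ⊗ₜ[ℂ] g)
    (hgS₂ : ∀ x : H,
      HopfAlgebra.antipode (R := ℂ) (HopfAlgebra.antipode (R := ℂ) x) * g = g * x)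
    -- a left integral `μˡ` and the right integral `μʳ = μˡ ∘ S⁻¹`
    (μl μr : Module.Dual ℂ H) (hμl0 : μl ≠ 0)
    (hμl : ∀ x : H, (TensorProduct.rid ℂ H)
        ((LinearMap.lTensor H μl) (Coalgebra.comul (R := ℂ) x)) = μl x • (1 : H))
    (hμr : μr = μl ∘ₗ Sinv) :
    ∀ x : H, μl x = μr (g * g * x) := by
  open Coalgebra HopfAlgebra in
  intro x
  have hμ : IsLeftIntegral μl := hμl
  obtain ⟨Λ, hμΛ, hμmul, hΛ⟩ := hμ.exists_leftCointegral hμl0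
  have hΛmul := hμ.leftCointegral_mul hμl0 hμΛ hΛ
  let χ : H →ₐ[ℂ] ℂ := AlgHom.ofLinearMap (μl ∘ₗ LinearMap.mulLeft ℂ Λ) (by simpa using hμΛ)
    fun y z ↦ by
      have h := congr(μl $(congr($(hΛmul y) * z)))
      simpa [mul_assoc] using h
  have hχ := sum_sum_character_smul_eq_one hv₁ hεv hΔv χ
    (hμ.rid_lTensor_comul_of_central hμmul hvcentral hSv)
  have hε := sum_sum_character_smul_eq_one hv₁ hεv hΔv (Bialgebra.counitAlgHom ℂ H)
    (by simpa [-lTensor_counit_comul] using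
      congr(TensorProduct.rid ℂ H $(lTensor_counit_comul (R := ℂ) v)))
  have hχε : χ.toLinearMap = counit (R := ℂ) := hfact.1 (hχ.trans hε.symm)
  have hΛμ (y : H) : μl (Λ * y) = counit (R := ℂ) y := congr($hχε y)
  set A := TensorProduct.lid ℂ H (μl.rTensor H (comul Λ)) with hA
  have hSA : antipode ℂ A = g * g := by
    have hu := hμ.antipode_lid_rTensor_comul_mul hSinv₁ hSinv₂ hRinv hRΔ hR₁ hR₂ hΛ hΛμ
    rw [← hA] at hu
    have hgv : ∑ i, antipode ℂ (bR i) * aR i = g * v := by rw [hg, mul_assoc, hv₂, mul_one]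
    rw [hgv, antipode_mul_antidistrib, hSv, hvcentral] at hu
    have hu' := congr($hu * vinv)
    simp only [mul_assoc, hv₁, mul_one] at hu'
    have hg' : IsGroupLikeElem ℂ g := by
      refine ⟨?_, hggrouplike⟩
      have h := congr((TensorProduct.lid ℂ H $(rTensor_counit_comul (R := ℂ) g)) * gi)
      rw [hggrouplike] at h
      simpa [hgi₁] using congr(counit (R := ℂ) ($h))
    calc antipode ℂ A = antipode ℂ A * (antipode ℂ g * g) := by simp [hg'.antipode_mul_cancel]
      _ = g * g := by rw [← mul_assoc, hu']
  have hmul (y z : H) : Sinv (y * z) = Sinv z * Sinv y :=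
    (Function.LeftInverse.injective hSinv₁)
      (by simp only [antipode_mul_antidistrib, hSinv₂])
  have hxA : TensorProduct.lid ℂ H (μl.rTensor H ((x ⊗ₜ 1) * comul Λ)) = Sinv x * A := by
    have h := antipode_tmul_one_mul_comul_leftCointegral hΛ (Sinv x)
    rw [hSinv₂] at h
    rw [h, hA, ← (ℛ ℂ Λ).eq]
    simp [Finset.mul_sum]
  have hμx : μl (TensorProduct.lid ℂ H (μl.rTensor H ((x ⊗ₜ 1) * comul Λ))) = μl x := by
    have h := congr(μl (x * $(hμ Λ)))
    rw [hμΛ, one_smul, mul_one, ← (ℛ ℂ Λ).eq] at h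
    rw [← h, ← (ℛ ℂ Λ).eq]
    simp [Finset.mul_sum, mul_comm]
  rw [hμr, LinearMap.comp_apply, hmul, ← hSA, hSinv₁, ← hxA, hμx]

end
end
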